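/- arXiv:2601.19595 — 9 statements merged into one kernel-verified Lean document; each statement's English description precedes it below -/
import Mathlib

section
/- Let μ be a probability measure on a measurable space Ω, let H ⊆ Ω be a measurable set with 0 < μ(H) < 1, and let S ⊆ Ω be a measurable set with μ(S) > 0. Then |μ[S|H] − μ[S|Hᶜ]| = μ(S)·|μ(H) − μ[H|S]| / (μ(H)·μ(Hᶜ)); that is, the Subgroup Discrepancy of S between the conditional distributions of positively- and negatively-classified samples equals the Statistical Parity Subgroup Fairness value of S divided by μ(H)·μ(Hᶜ). -/
open MeasureTheory

/-- Conditional probability `μ[A|B] = μ(A ∩ B) / μ(B)`, as a real number. -/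
noncomputable def condP {Ω : Type*} [MeasurableSpace Ω] (μ : Measure Ω) (A B : Set Ω) : ℝ :=
  (μ (A ∩ B)).toReal / (μ B).toReal

/-- The Subgroup Discrepancy of `S` between the conditional distributions of positively-
and negatively-classified samples equals the SPSF value of `S` divided by `μ(H)·μ(Hᶜ)`. -/
theorem sd_eq_spsf_div {Ω : Type*} [MeasurableSpace Ω] (μ : Measure Ω)
    [IsProbabilityMeasure μ] (H S : Set Ω) (hH : MeasurableSet H) (hS : MeasurableSet S)
    (hH0 : 0 < μ H) (hH1 : μ H < 1) (hS0 : 0 < μ S) :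
    |condP μ S H - condP μ S Hᶜ| =
      (μ S).toReal * |(μ H).toReal - condP μ H S| / ((μ H).toReal * (μ Hᶜ).toReal) := by
  have hp : 0 < (μ H).toReal := ENNReal.toReal_pos hH0.ne' (measure_ne_top μ H)
  have hs : 0 < (μ S).toReal := ENNReal.toReal_pos hS0.ne' (measure_ne_top μ S)
  have hp1 : (μ H).toReal < 1 := by
    have h := (ENNReal.toReal_lt_toReal (measure_ne_top μ H) ENNReal.one_ne_top).2 hH1
    simpa using h
  have hq : (μ Hᶜ).toReal = 1 - (μ H).toReal := probReal_compl_eq_one_sub hH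
  have hsum : (μ (S ∩ H)).toReal + (μ (S ∩ Hᶜ)).toReal = (μ S).toReal := by
    rw [← ENNReal.toReal_add (measure_ne_top μ _) (measure_ne_top μ _), ← Set.diff_eq,
      measure_inter_add_diff S hH]
  have hb : (μ (S ∩ Hᶜ)).toReal = (μ S).toReal - (μ (S ∩ H)).toReal := by linarith
  unfold condP
  rw [Set.inter_comm H S, hb, hq]
  generalize (μ (S ∩ H)).toReal = a at *
  generalize (μ H).toReal = p at *
  generalize (μ S).toReal = s at *
  have hq0 : 0 < 1 - p := by linarith
  have h1 : a / p - (s - a) / (1 - p) = -(s * (p - a / s) / (p * (1 - p))) := by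
    field_simp
    ring
  rw [h1, abs_neg, abs_div, abs_mul, abs_of_pos hs, abs_of_pos (mul_pos hp hq0)]
end

section
/- Let μ be a probability measure on a measurable space Ω, let H ⊆ Ω be measurable with 0 < μ(H) < 1, and let S₁, S₂ ⊆ Ω be measurable sets with μ(S₁) > 0 and μ(S₂) > 0. Then SPSF(H,S₁) ≤ SPSF(H,S₂) if and only if SD(S₁) ≤ SD(S₂), where SPSF(H,S) := μ(S)·|μ(H) − μ[H|S]| and SD(S) := |μ[S|H] − μ[S|Hᶜ]|. -/
open MeasureTheory

/-- Statistical Parity Subgroup Fairness value of subgroup `S` for classifier `H`. -/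
noncomputable def SPSF {Ω : Type*} [MeasurableSpace Ω] (μ : Measure Ω) (H S : Set Ω) : ℝ :=
  (μ S).toReal * |(μ H).toReal - condP μ H S|

/-- Subgroup Discrepancy of `S` between the conditional distributions of positively-
and negatively-classified samples. -/
noncomputable def SD {Ω : Type*} [MeasurableSpace Ω] (μ : Measure Ω) (H S : Set Ω) : ℝ :=
  |condP μ S H - condP μ S Hᶜ|

theorem spsf_eq_aux {Ω : Type*} [MeasurableSpace Ω] (μ : Measure Ω)
    [IsProbabilityMeasure μ] (H S : Set Ω) (hH : MeasurableSet H)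
    (hH0 : 0 < μ H) (hH1 : μ H < 1) (hS0 : 0 < μ S) :
    SPSF μ H S = ((μ H).toReal * (1 - (μ H).toReal)) * SD μ H S := by
  have a0 : 0 < (μ H).toReal := ENNReal.toReal_pos hH0.ne' (measure_ne_top _ _)
  have s0 : 0 < (μ S).toReal := ENNReal.toReal_pos hS0.ne' (measure_ne_top _ _)
  have a1 : (μ H).toReal < 1 := by
    have := (ENNReal.toReal_lt_toReal (measure_ne_top μ H) ENNReal.one_ne_top).2 hH1
    simpa using this
  have hc : (μ Hᶜ).toReal = 1 - (μ H).toReal := by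
    have := probReal_compl_eq_one_sub (μ := μ) hH
    simpa [Measure.real] using this
  have hs : (μ (S ∩ H)).toReal + (μ (S ∩ Hᶜ)).toReal = (μ S).toReal := by
    rw [← ENNReal.toReal_add (measure_ne_top _ _) (measure_ne_top _ _), ← Set.sdiff_eq,
      measure_inter_add_sdiff S hH]
  unfold SPSF SD condP
  rw [Set.inter_comm H S, hc]
  generalize (μ H).toReal = a at *
  generalize (μ S).toReal = s at *
  generalize (μ (S ∩ H)).toReal = x at *
  generalize (μ (S ∩ Hᶜ)).toReal = y at *
  have b0 : 0 < 1 - a := by linarith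
  have hb : 1 - a ≠ 0 := b0.ne'
  rw [← abs_of_pos s0, ← abs_of_pos (mul_pos a0 b0), ← abs_mul, ← abs_mul, abs_of_pos s0, abs_eq_abs]
  right
  subst hs
  have e1 : (x + y) * (a - x / (x + y)) = (x + y) * a - x := by
    field_simp
  have e2 : a * (1 - a) * (x / a - y / (1 - a)) = (1 - a) * x - a * y := by
    field_simp
  rw [e1, e2]
  ring

/-- Comparison of SPSF values between two subgroups matches comparison of their
Subgroup Discrepancies. -/
theorem spsf_le_iff_sd_le {Ω : Type*} [MeasurableSpace Ω] (μ : Measure Ω)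
    [IsProbabilityMeasure μ] (H S₁ S₂ : Set Ω) (hH : MeasurableSet H)
    (hS₁ : MeasurableSet S₁) (hS₂ : MeasurableSet S₂)
    (hH0 : 0 < μ H) (hH1 : μ H < 1) (hS₁0 : 0 < μ S₁) (hS₂0 : 0 < μ S₂) :
    SPSF μ H S₁ ≤ SPSF μ H S₂ ↔ SD μ H S₁ ≤ SD μ H S₂ := by
  have a0 : 0 < (μ H).toReal := ENNReal.toReal_pos hH0.ne' (measure_ne_top _ _)
  have a1 : (μ H).toReal < 1 := by
    have := (ENNReal.toReal_lt_toReal (measure_ne_top μ H) ENNReal.one_ne_top).2 hH1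
    simpa using this
  rw [spsf_eq_aux μ H S₁ hH hH0 hH1 hS₁0, spsf_eq_aux μ H S₂ hH hH0 hH1 hS₂0]
  exact mul_le_mul_iff_right₀ (mul_pos a0 (by linarith))
end

section
/- Let μ be a probability measure on a measurable space Ω, let H ⊆ Ω be measurable with 0 < μ(H) < 1, let 𝒮 be a family of measurable subsets of Ω each of positive μ-measure, and let S₀ ∈ 𝒮. Then S₀ maximizes SPSF(H,·) over 𝒮 (i.e., SPSF(H,S) ≤ SPSF(H,S₀) for all S ∈ 𝒮) if and only if S₀ maximizes SD(·) over 𝒮 (i.e., SD(S) ≤ SD(S₀) for all S ∈ 𝒮). In particular, the set of subgroups in 𝒮 maximizing the SPSF metric is identical to the set of subgroups in 𝒮 achieving the maximum Subgroup Discrepancy between the distributions of positively- and negatively-classified samples. -/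
open MeasureTheory

/-- A subgroup `S₀ ∈ 𝒮` maximizes SPSF over `𝒮` iff it maximizes the Subgroup
Discrepancy over `𝒮`; hence the two sets of maximizers coincide. -/
theorem spsf_argmax_iff_sd_argmax {Ω : Type*} [MeasurableSpace Ω] (μ : Measure Ω)
    [IsProbabilityMeasure μ] (H : Set Ω) (hH : MeasurableSet H)
    (hH0 : 0 < μ H) (hH1 : μ H < 1) (𝒮 : Set (Set Ω))
    (h𝒮 : ∀ S ∈ 𝒮, MeasurableSet S ∧ 0 < μ S) (S₀ : Set Ω) (hS₀ : S₀ ∈ 𝒮) :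
    (∀ S ∈ 𝒮, SPSF μ H S ≤ SPSF μ H S₀) ↔ (∀ S ∈ 𝒮, SD μ H S ≤ SD μ H S₀) := by
  have hp0 : 0 < μ.real H := ENNReal.toReal_pos hH0.ne' (measure_ne_top μ H)
  have hc : μ.real Hᶜ = 1 - μ.real H := probReal_compl_eq_one_sub hH
  have hp1 : 0 < 1 - μ.real H := by
    have h := (ENNReal.toReal_lt_toReal (measure_ne_top μ H) ENNReal.one_ne_top).2 hH1
    rw [ENNReal.toReal_one] at h
    exact sub_pos.2 h
  have hk : 0 < μ.real H * (1 - μ.real H) := mul_pos hp0 hp1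
  have key : ∀ S ∈ 𝒮, SPSF μ H S = μ.real H * (1 - μ.real H) * SD μ H S := by
    intro S hS
    have hs : 0 < μ.real S := ENNReal.toReal_pos (h𝒮 S hS).2.ne' (measure_ne_top μ S)
    have hadd : μ.real (S ∩ H) + μ.real (S ∩ Hᶜ) = μ.real S := by
      rw [← Set.diff_eq]
      exact measureReal_inter_add_diff hH
    change μ.real S * |μ.real H - μ.real (H ∩ S) / μ.real S|
      = μ.real H * (1 - μ.real H) *
        |μ.real (S ∩ H) / μ.real H - μ.real (S ∩ Hᶜ) / μ.real Hᶜ|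
    rw [hc, Set.inter_comm H S]
    generalize μ.real (S ∩ H) = a at *
    generalize μ.real (S ∩ Hᶜ) = b at *
    generalize μ.real S = s at *
    generalize μ.real H = p at *
    rw [← abs_of_pos hs, ← abs_of_pos hk, abs_of_pos hs]
    nth_rewrite 1 [← abs_of_pos hs]
    rw [← abs_mul, ← abs_mul, ← abs_neg]
    congr 1
    have := hp1.ne'
    field_simp
    rw [← hadd]
    ring
  refine forall₂_congr fun S hS => ?_
  rw [key S hS, key S₀ hS₀, mul_le_mul_iff_right₀ hk]
end

section
/- Let μ be a probability measure on a measurable space Ω, let H ⊆ Ω be measurable with 0 < μ(H) < 1, and let 𝒮 be a nonempty family of measurable subsets of Ω each of positive μ-measure. Then sup_{S ∈ 𝒮} SD(S) = (sup_{S ∈ 𝒮} SPSF(H,S)) / (μ(H)·μ(Hᶜ)), where both suprema are taken in the reals (they exist since SD(S) ≤ 1 and SPSF(H,S) ≤ 1 for all S). -/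
open MeasureTheory

/-- The Maximum Subgroup Discrepancy over a nonempty family `𝒮` equals the supremum
of SPSF over `𝒮` divided by `μ(H)·μ(Hᶜ)`. -/
theorem msd_eq_sup_spsf_div {Ω : Type*} [MeasurableSpace Ω] (μ : Measure Ω)
    [IsProbabilityMeasure μ] (H : Set Ω) (hH : MeasurableSet H)
    (hH0 : 0 < μ H) (hH1 : μ H < 1) (𝒮 : Set (Set Ω)) (hne : 𝒮.Nonempty)
    (h𝒮 : ∀ S ∈ 𝒮, MeasurableSet S ∧ 0 < μ S) :
    (⨆ S : 𝒮, SD μ H (S : Set Ω)) =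
      (⨆ S : 𝒮, SPSF μ H (S : Set Ω)) / ((μ H).toReal * (μ Hᶜ).toReal) := by
  have hh : 0 < (μ H).toReal := ENNReal.toReal_pos hH0.ne' (measure_ne_top μ H)
  have hk : (μ Hᶜ).toReal = 1 - (μ H).toReal := probReal_compl_eq_one_sub hH
  have hh1 : (μ H).toReal < 1 := by
    have := (ENNReal.toReal_lt_toReal (measure_ne_top μ H) ENNReal.one_ne_top).2 hH1
    simpa using this
  rw [div_eq_mul_inv, Real.iSup_mul_of_nonneg (by positivity)]
  congr 1
  funext S
  obtain ⟨S, hS⟩ := S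
  have hs : 0 < (μ S).toReal := ENNReal.toReal_pos (h𝒮 S hS).2.ne' (measure_ne_top μ S)
  have hsum : (μ (S ∩ H)).toReal + (μ (S ∩ Hᶜ)).toReal = (μ S).toReal := by
    have := measureReal_inter_add_sdiff (μ := μ) (s := S) hH
    rwa [Set.sdiff_eq] at this
  have hkpos : 0 < 1 - (μ H).toReal := by linarith
  simp only [SD, SPSF, condP]
  rw [Set.inter_comm H S, hk]
  generalize (μ (S ∩ H)).toReal = a at *
  generalize (μ (S ∩ Hᶜ)).toReal = b at *
  generalize (μ S).toReal = s at *
  generalize (μ H).toReal = h at *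
  have hpos : 0 < (h * (1 - h))⁻¹ := by positivity
  rw [← abs_of_pos hs, ← abs_of_pos hpos, ← abs_mul, ← abs_mul, abs_of_pos hs, abs_sub_comm]
  congr 1
  subst hsum
  field_simp
  ring
end

section
/- Let μ be a probability measure on a measurable space Ω, let H ⊆ Ω be measurable with 0 < μ(H) < 1, let 𝒮 be a family of measurable subsets of Ω each of positive μ-measure, and let γ ≥ 0. Then the classifier satisfies γ-SPSF fairness with respect to 𝒮 (i.e., SPSF(H,S) ≤ γ for all S ∈ 𝒮) if and only if SD(S) ≤ γ / (μ(H)·μ(Hᶜ)) for all S ∈ 𝒮. -/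
open MeasureTheory

/-- `γ`-SPSF fairness with respect to `𝒮` holds iff the Subgroup Discrepancy of every
subgroup in `𝒮` is at most `γ / (μ(H)·μ(Hᶜ))`. -/
theorem gamma_spsf_iff_sd_bound {Ω : Type*} [MeasurableSpace Ω] (μ : Measure Ω)
    [IsProbabilityMeasure μ] (H : Set Ω) (hH : MeasurableSet H)
    (hH0 : 0 < μ H) (hH1 : μ H < 1) (𝒮 : Set (Set Ω))
    (h𝒮 : ∀ S ∈ 𝒮, MeasurableSet S ∧ 0 < μ S) (γ : ℝ) (hγ : 0 ≤ γ) :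
    (∀ S ∈ 𝒮, SPSF μ H S ≤ γ) ↔
      (∀ S ∈ 𝒮, SD μ H S ≤ γ / ((μ H).toReal * (μ Hᶜ).toReal)) := by
  have key : ∀ S ∈ 𝒮, SD μ H S = SPSF μ H S / ((μ H).toReal * (μ Hᶜ).toReal) := by
    intro S hS
    obtain ⟨_, hS0⟩ := h𝒮 S hS
    have hp : 0 < (μ H).toReal := ENNReal.toReal_pos hH0.ne' (measure_ne_top μ H)
    have hs : 0 < (μ S).toReal := ENNReal.toReal_pos hS0.ne' (measure_ne_top μ S)
    have hqe : (μ Hᶜ).toReal = 1 - (μ H).toReal := probReal_compl_eq_one_sub hH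
    have hp1 : (μ H).toReal < 1 := by
      have := (ENNReal.toReal_lt_toReal (measure_ne_top μ H) ENNReal.one_ne_top).2 hH1
      simpa using this
    have hq : 0 < (μ Hᶜ).toReal := by rw [hqe]; linarith
    have hsum : (μ (S ∩ H)).toReal + (μ (S ∩ Hᶜ)).toReal = (μ S).toReal := by
      rw [← ENNReal.toReal_add (measure_ne_top μ _) (measure_ne_top μ _),
        ← Set.sdiff_eq, measure_inter_add_sdiff S hH]
    unfold SD SPSF condP
    rw [Set.inter_comm H S]
    generalize (μ (S ∩ H)).toReal = a at *
    generalize (μ (S ∩ Hᶜ)).toReal = b at *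
    generalize (μ Hᶜ).toReal = q at *
    generalize (μ H).toReal = p at *
    generalize (μ S).toReal = s at *
    have hpq : 0 < p * q := mul_pos hp hq
    rw [eq_div_iff hpq.ne']
    nth_rewrite 1 [← abs_of_pos hpq]
    nth_rewrite 1 [← abs_of_pos hs]
    rw [← abs_mul, ← abs_mul]
    have h1 : (a / p - b / q) * (p * q) = a * q - b * p := by field_simp
    have h2 : s * (p - a / s) = s * p - a := by field_simp
    rw [h1, h2, abs_sub_comm (s * p), ← hsum, hqe]
    congr 1
    ring
  have hpos : 0 < (μ H).toReal * (μ Hᶜ).toReal := by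
    refine mul_pos (ENNReal.toReal_pos hH0.ne' (measure_ne_top μ H))
      (ENNReal.toReal_pos ?_ (measure_ne_top μ _))
    rw [prob_compl_eq_one_sub hH]
    exact (tsub_pos_of_lt hH1).ne'
  refine forall₂_congr fun S hS => ?_
  rw [key S hS, div_le_div_iff_of_pos_right hpos]
end

section
/- Let μ be a probability measure on a measurable space Ω, let H, S, Y₀ ⊆ Ω be measurable with μ(Y₀) > 0 and μ(S∩Y₀) > 0, and let ν := μ[·|Y₀] be the conditional probability measure given Y₀. Then the False Positive Subgroup Fairness value satisfies FPSF(H,S) = μ(Y₀) · ( ν(S)·|ν(H) − ν[H|S]| ); that is, FPSF equals μ(Y₀) times the Statistical Parity Subgroup Fairness value computed under the conditional distribution of negatively-labeled samples. -/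
open MeasureTheory ProbabilityTheory

/-- False Positive Subgroup Fairness equals `μ(Y₀)` times the SPSF value computed
under the conditional distribution `ν := μ[·|Y₀]` of negatively-labeled samples. -/
theorem fpsf_eq_mul_spsf_cond {Ω : Type*} [MeasurableSpace Ω] (μ : Measure Ω)
    [IsProbabilityMeasure μ] (H S Y₀ : Set Ω)
    (hH : MeasurableSet H) (hS : MeasurableSet S) (hY₀ : MeasurableSet Y₀)
    (hY₀0 : 0 < μ Y₀) (hSY₀ : 0 < μ (S ∩ Y₀)) :
    (μ (S ∩ Y₀)).toReal * |condP μ H Y₀ - condP μ H (S ∩ Y₀)| =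
      (μ Y₀).toReal *
        (((μ[|Y₀]) S).toReal * |((μ[|Y₀]) H).toReal - condP (μ[|Y₀]) H S|) := by
  have hy : 0 < (μ Y₀).toReal := ENNReal.toReal_pos hY₀0.ne' (measure_ne_top μ _)
  have hs : 0 < (μ (S ∩ Y₀)).toReal := ENNReal.toReal_pos hSY₀.ne' (measure_ne_top μ _)
  have key : ∀ A : Set Ω, ((μ[|Y₀]) A).toReal = (μ (A ∩ Y₀)).toReal / (μ Y₀).toReal := by
    intro A
    rw [cond_apply hY₀, ENNReal.toReal_mul, ENNReal.toReal_inv, Set.inter_comm, div_eq_inv_mul]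
  unfold condP
  rw [key, key, key, Set.inter_assoc, div_div_div_cancel_right₀ hy.ne', ← mul_assoc,
    mul_div_cancel₀ _ hy.ne']
end

section
/- Let μ be a probability measure on a measurable space Ω, let H, Y₀ ⊆ Ω be measurable with μ(Y₀) > 0, let ν := μ[·|Y₀] be the conditional probability measure given Y₀, and suppose 0 < ν(H) < 1. Let 𝒮 be a family of measurable subsets of Ω with ν(S) > 0 for every S ∈ 𝒮, and let γ ≥ 0. Then the classifier satisfies γ-FPSF fairness with respect to 𝒮 (i.e., FPSF(H,S) ≤ γ for all S ∈ 𝒮) if and only if for every S ∈ 𝒮, |ν[S|H] − ν[S|Hᶜ]| ≤ γ / (μ(Y₀)·ν(H)·ν(Hᶜ)); that is, γ-FPSF fairness is certified by bounding the Subgroup Discrepancy computed on the conditional distribution of negatively-labeled samples. -/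
open MeasureTheory ProbabilityTheory

/-- False Positive Subgroup Fairness value of subgroup `S` for classifier `H`,
with `Y₀` the set of negatively-labeled samples. -/
noncomputable def FPSF {Ω : Type*} [MeasurableSpace Ω] (μ : Measure Ω)
    (H S Y₀ : Set Ω) : ℝ :=
  (μ (S ∩ Y₀)).toReal * |condP μ H Y₀ - condP μ H (S ∩ Y₀)|

/-- `γ`-FPSF fairness with respect to `𝒮` holds iff, for every `S ∈ 𝒮`, the Subgroup
Discrepancy computed under the conditional distribution `ν := μ[·|Y₀]` of
negatively-labeled samples is at most `γ / (μ(Y₀)·ν(H)·ν(Hᶜ))`. -/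
theorem gamma_fpsf_iff_sd_bound {Ω : Type*} [MeasurableSpace Ω] (μ : Measure Ω)
    [IsProbabilityMeasure μ] (H Y₀ : Set Ω)
    (hH : MeasurableSet H) (hY₀ : MeasurableSet Y₀) (hY₀0 : 0 < μ Y₀)
    (hνH0 : 0 < (μ[|Y₀]) H) (hνH1 : (μ[|Y₀]) H < 1)
    (𝒮 : Set (Set Ω)) (h𝒮 : ∀ S ∈ 𝒮, MeasurableSet S ∧ 0 < (μ[|Y₀]) S)
    (γ : ℝ) (hγ : 0 ≤ γ) :
    (∀ S ∈ 𝒮, FPSF μ H S Y₀ ≤ γ) ↔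
      (∀ S ∈ 𝒮, |condP (μ[|Y₀]) S H - condP (μ[|Y₀]) S Hᶜ| ≤
        γ / ((μ Y₀).toReal * ((μ[|Y₀]) H).toReal * ((μ[|Y₀]) Hᶜ).toReal)) := by
  have hm : 0 < (μ Y₀).toReal := ENNReal.toReal_pos hY₀0.ne' (measure_ne_top _ _)
  have : IsProbabilityMeasure (μ[|Y₀]) := cond_isProbabilityMeasure hY₀0.ne'
  have key : ∀ A : Set Ω, (μ (A ∩ Y₀)).toReal = (μ Y₀).toReal * ((μ[|Y₀]) A).toReal := by
    intro A
    rw [cond_apply hY₀, ENNReal.toReal_mul, ENNReal.toReal_inv, Set.inter_comm]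
    field_simp
  have hh : 0 < ((μ[|Y₀]) H).toReal := ENNReal.toReal_pos hνH0.ne' (measure_ne_top _ _)
  have hc : ((μ[|Y₀]) H).toReal + ((μ[|Y₀]) Hᶜ).toReal = 1 := by
    have := probReal_add_probReal_compl (μ := μ[|Y₀]) hH
    simpa only [Measure.real] using this
  have hh1 : ((μ[|Y₀]) H).toReal < 1 := by
    have := (ENNReal.toReal_lt_toReal (measure_ne_top _ _) ENNReal.one_ne_top).2 hνH1
    simpa using this
  refine forall₂_congr fun S hS => ?_
  obtain ⟨-, hS0⟩ := h𝒮 S hS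
  have hs : 0 < ((μ[|Y₀]) S).toReal := ENNReal.toReal_pos hS0.ne' (measure_ne_top _ _)
  have hsplit : ((μ[|Y₀]) (S ∩ H)).toReal + ((μ[|Y₀]) (S ∩ Hᶜ)).toReal
      = ((μ[|Y₀]) S).toReal := by
    have := measureReal_inter_add_sdiff (μ := μ[|Y₀]) (s := S) hH
    simpa only [Measure.real, Set.sdiff_eq] using this
  unfold FPSF condP
  rw [← Set.inter_assoc, Set.inter_comm H S, key H, key S, key (S ∩ H)]
  generalize ((μ[|Y₀]) (S ∩ H)).toReal = a at *
  generalize ((μ[|Y₀]) (S ∩ Hᶜ)).toReal = b at *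
  generalize ((μ[|Y₀]) S).toReal = s at *
  generalize ((μ[|Y₀]) H).toReal = h at *
  generalize ((μ[|Y₀]) Hᶜ).toReal = k at *
  generalize (μ Y₀).toReal = m at *
  have hk : 0 < k := by linarith
  have e : m * s * |m * h / m - m * a / (m * s)| = |a / h - b / k| * (m * h * k) := by
    have e1 : m * s * |m * h / m - m * a / (m * s)|
        = |(m * s) * (m * h / m - m * a / (m * s))| := by
      rw [abs_mul, abs_of_pos (mul_pos hm hs)]
    have e2 : |a / h - b / k| * (m * h * k) = |(a / h - b / k) * (m * h * k)| := by
      rw [abs_mul, abs_of_pos (mul_pos (mul_pos hm hh) hk)]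
    rw [e1, e2, ← abs_neg]
    congr 1
    obtain rfl : b = s - a := by linarith
    obtain rfl : k = 1 - h := by linarith
    have := hk.ne'
    field_simp
    ring
  rw [e, le_div_iff₀ (by positivity)]
end

section
/- Let μ be a probability measure on a measurable space Ω, let H ⊆ Ω be measurable, and let S ⊆ Ω be measurable with μ(S) > 0. Then the Statistical Parity Subgroup Fairness value satisfies SPSF(H,S) = μ(S)·|μ(H) − μ[H|S]| ≤ μ(H)·μ(Hᶜ), and consequently SPSF(H,S) ≤ 1/4. -/
open MeasureTheory

/-- The SPSF value is at most `μ(H)·μ(Hᶜ)`, and consequently at most `1/4`. -/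
theorem spsf_le_bound {Ω : Type*} [MeasurableSpace Ω] (μ : Measure Ω)
    [IsProbabilityMeasure μ] (H S : Set Ω) (hH : MeasurableSet H) (hS : MeasurableSet S)
    (hS0 : 0 < μ S) :
    (μ S).toReal * |(μ H).toReal - condP μ H S| ≤ (μ H).toReal * (μ Hᶜ).toReal ∧
      (μ S).toReal * |(μ H).toReal - condP μ H S| ≤ 1 / 4 := by
  have hs : (0:ℝ) < μ.real S := ENNReal.toReal_pos hS0.ne' (measure_ne_top μ S)
  have hc : μ.real Hᶜ = 1 - μ.real H := probReal_compl_eq_one_sub hH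
  have h1 : μ.real (S ∩ H) + μ.real (S \ H) = μ.real S := measureReal_inter_add_diff hH
  have h2 : μ.real (H ∩ S) ≤ μ.real H := measureReal_mono Set.inter_subset_left
  have h3 : μ.real (S \ H) ≤ μ.real Hᶜ := measureReal_mono (fun x hx => hx.2)
  have h4 : 0 ≤ μ.real (H ∩ S) := measureReal_nonneg
  have h5 : 0 ≤ μ.real (S \ H) := measureReal_nonneg
  have h6 : 0 ≤ μ.real H := measureReal_nonneg
  rw [Set.inter_comm] at h1
  have key : μ.real S * |μ.real H - condP μ H S| ≤ μ.real H * μ.real Hᶜ := by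
    have e : μ.real S * |μ.real H - condP μ H S|
        = |μ.real S * μ.real H - μ.real (H ∩ S)| := by
      rw [← abs_of_pos hs, ← abs_mul, abs_of_pos hs, mul_sub]
      congr 2
      exact mul_div_cancel₀ _ hs.ne'
    rw [e, abs_le, ← h1]
    rw [hc] at *
    constructor <;> nlinarith [mul_nonneg h4 (h5.trans h3), mul_nonneg h5 h6,
      mul_le_mul_of_nonneg_right h2 (h5.trans h3), mul_le_mul_of_nonneg_right h3 h6]
  refine ⟨key, key.trans ?_⟩
  rw [hc]
  nlinarith [sq_nonneg (μ.real H - 1 / 2)]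
end

section
/- Let J be a finite index set, let x, u : J → ℝ take values in {0,1}, and let y ∈ ℝ satisfy 0 ≤ y ≤ 1, y ≤ 1 − (u j − x j · u j) for every j ∈ J, and y ≥ 1 − Σ_{j ∈ J} (u j − x j · u j). Then y = 1 if u j = 1 implies x j = 1 for every j ∈ J, and y = 0 otherwise. In particular, in the conjunction-subgroup MIO formulation the membership variables y may be relaxed to be real-valued in [0,1] without changing their (integral) values: y is forced to equal the indicator of the conjunction defined by u evaluated at x. -/
/-- In the conjunction-subgroup MIO formulation, the relaxed membership variable `y`
is forced to equal the indicator of the conjunction defined by `u` evaluated at `x`: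
`y = 1` if `u j = 1 → x j = 1` for all `j`, and `y = 0` otherwise. -/
theorem conjunction_membership_exact {J : Type*} [Fintype J]
    (x u : J → ℝ) (hx : ∀ j, x j = 0 ∨ x j = 1) (hu : ∀ j, u j = 0 ∨ u j = 1)
    (y : ℝ) (hy0 : 0 ≤ y) (hy1 : y ≤ 1)
    (hub : ∀ j, y ≤ 1 - (u j - x j * u j))
    (hlb : y ≥ 1 - ∑ j, (u j - x j * u j)) :
    (((∀ j, u j = 1 → x j = 1) → y = 1) ∧ ((¬ ∀ j, u j = 1 → x j = 1) → y = 0)) := by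
  constructor
  · intro h
    have hs : ∑ j, (u j - x j * u j) = 0 := by
      apply Finset.sum_eq_zero
      intro j _
      rcases hu j with h0 | h1
      · rw [h0]; ring
      · rw [h j h1]; ring
    rw [hs] at hlb
    linarith
  · intro h
    push Not at h
    obtain ⟨j, h1, h2⟩ := h
    have h3 := hub j
    have h4 : x j = 0 := (hx j).resolve_right h2
    rw [h1, h4] at h3
    linarith
end
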